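/- Let the Euclidean plane ℝ² be coloured in red and blue so that there is no red ℓ₂ and no blue ℓ₅. Then for every red point A, every point P at Euclidean distance 5 from A is also red; equivalently, no two points at distance 5 from each other receive different colours. -/

import Mathlib

/-- The two colours. -/
inductive Color
  | red
  | blue

/-- The Euclidean plane ℝ². -/
abbrev Plane : Type := EuclideanSpace ℝ (Fin 2)

/-- There is no red ℓ₂, i.e. no two red points at Euclidean distance 1. -/
def NoRedL2 (c : Plane → Color) : Prop :=
  ∀ x y : Plane, c x = Color.red → c y = Color.red → dist x y ≠ 1

/-- There is a blue ℓ₅: a point `p` and a unit vector `w` such that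
`p, p+w, p+2w, p+3w, p+4w` are all blue. -/
def HasBlueL5 (c : Plane → Color) : Prop :=
  ∃ p w : Plane, ‖w‖ = 1 ∧ ∀ i : Fin 5, c (p + (i : ℝ) • w) = Color.blue

/-- A set of (red) points of the complex plane which contains no two points at distance `1` and
meets every unit-step five-term arithmetic progression. -/
structure IsRedClass (R : Set ℂ) : Prop where
  dist_ne_one : ∀ x ∈ R, ∀ y ∈ R, dist x y ≠ 1
  exists_mem : ∀ p w : ℂ, ‖w‖ = 1 → ∃ i : Fin 5, p + (i : ℝ) • w ∈ R

namespace IsRedClass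

/-- The primitive sixth root of unity `exp (iπ/3)`. -/
noncomputable def omega : ℂ := ⟨1 / 2, √3 / 2⟩

/-- The rotation by `arccos (5/6)`, which moves points at distance `√3` from the origin by
exactly `1`. -/
noncomputable def rho : ℂ := ⟨5 / 6, √11 / 6⟩

/-- Points of the module generated by `1` and `rho` over the Eisenstein integers. -/
noncomputable def latticePoint (a b c d : ℤ) : ℂ :=
  a + b * omega + rho * (c + d * omega)

theorem dist_latticePoint {a b c d a' b' c' d' : ℤ} (n : ℕ)
    (hdet : (a - a') * (d - d') = (b - b') * (c - c'))
    (hquad : 6 * ((a - a') ^ 2 + (a - a') * (b - b') + (b - b') ^ 2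
      + (c - c') ^ 2 + (c - c') * (d - d') + (d - d') ^ 2)
      + 10 * ((a - a') * (c - c') + (b - b') * (d - d'))
      + 5 * ((a - a') * (d - d') + (b - b') * (c - c')) = 6 * n ^ 2) :
    dist (latticePoint a b c d) (latticePoint a' b' c' d') = n := by
  have h3 : √3 ^ 2 = (3 : ℝ) := Real.sq_sqrt (by norm_num)
  have h11 : √11 ^ 2 = (11 : ℝ) := Real.sq_sqrt (by norm_num)
  have hsub : latticePoint a b c d - latticePoint a' b' c' d' =
      latticePoint (a - a') (b - b') (c - c') (d - d') := by
    simp only [latticePoint]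
    push_cast
    ring
  rw [dist_eq_norm, hsub]
  generalize a - a' = a at *
  generalize b - b' = b at *
  generalize c - c' = c at *
  generalize d - d' = d at *
  have hdet' : (a * d : ℝ) = b * c := by exact_mod_cast hdet
  have hquad' : (6 * (a ^ 2 + a * b + b ^ 2 + c ^ 2 + c * d + d ^ 2)
      + 10 * (a * c + b * d) + 5 * (a * d + b * c) : ℝ) = 6 * n ^ 2 := by exact_mod_cast hquad
  rw [← sq_eq_sq₀ (norm_nonneg _) (Nat.cast_nonneg n), ← Complex.normSq_eq_norm_sq,
    Complex.normSq_apply]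
  simp only [latticePoint, omega, rho, Complex.add_re, Complex.add_im, Complex.mul_re,
    Complex.mul_im, Complex.intCast_re, Complex.intCast_im]
  generalize √3 = s at *
  generalize √11 = t at *
  linear_combination hquad' / 6 - s * t / 6 * hdet'
    + ((b + 5 / 6 * d) ^ 2 / 4 + t ^ 2 * d ^ 2 / 144) * h3
    + ((c + d / 2) ^ 2 / 36 + d ^ 2 / 48) * h11

theorem preimage {R : Set ℂ} (hR : IsRedClass R) (x : ℂ) {u : ℂ} (hu : ‖u‖ = 1) :
    IsRedClass {z | x + u * z ∈ R} where
  dist_ne_one y hy z hz := by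
    simpa [dist_eq_norm, ← mul_sub, hu] using hR.dist_ne_one _ hy _ hz
  exists_mem p w hw := by
    obtain ⟨i, hi⟩ := hR.exists_mem (x + u * p) (u * w) (by simp [hu, hw])
    exact ⟨i, by simpa [mul_add, add_assoc, mul_left_comm u] using hi⟩

/-- It suffices to exclude a distance on the real axis. -/
theorem dist_ne_of_normalized {n : ℕ} (hn : n ≠ 0)
    (h : ∀ R : Set ℂ, IsRedClass R → latticePoint 0 0 0 0 ∈ R → latticePoint n 0 0 0 ∉ R)
    {R : Set ℂ} (hR : IsRedClass R) {x y : ℂ} (hx : x ∈ R) (hy : y ∈ R) : dist x y ≠ n := by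
  intro hxy
  have hn' : (n : ℂ) ≠ 0 := by exact_mod_cast hn
  have hu : ‖(y - x) / n‖ = 1 := by
    rw [norm_div, ← dist_eq_norm, dist_comm, hxy, Complex.norm_natCast]
    exact div_self (by exact_mod_cast hn)
  refine h _ (hR.preimage x hu) ?_ ?_
  · simpa [latticePoint] using hx
  · have : x + (y - x) / n * n = y := by field_simp; ring
    simpa [latticePoint, this] using hy

variable {R : Set ℂ}

theorem not_mem_of_unit (hR : IsRedClass R) {a b c d : ℤ} (h : latticePoint a b c d ∈ R)
    (a' b' c' d' : ℤ) (hdet : (a - a') * (d - d') = (b - b') * (c - c'))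
    (hquad : 6 * ((a - a') ^ 2 + (a - a') * (b - b') + (b - b') ^ 2
      + (c - c') ^ 2 + (c - c') * (d - d') + (d - d') ^ 2)
      + 10 * ((a - a') * (c - c') + (b - b') * (d - d'))
      + 5 * ((a - a') * (d - d') + (b - b') * (c - c')) = 6) :
    latticePoint a' b' c' d' ∉ R := fun h' =>
  hR.dist_ne_one _ h _ h' (by simpa using dist_latticePoint 1 hdet (by simpa using hquad))

theorem exists_mem_line (hR : IsRedClass R) (a b c d a' b' c' d' : ℤ)
    (hdet : a' * d' = b' * c')
    (hquad : 6 * (a' ^ 2 + a' * b' + b' ^ 2 + c' ^ 2 + c' * d' + d' ^ 2)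
      + 10 * (a' * c' + b' * d') + 5 * (a' * d' + b' * c') = 6) :
    latticePoint a b c d ∈ R ∨
    latticePoint (a + a') (b + b') (c + c') (d + d') ∈ R ∨
    latticePoint (a + 2 * a') (b + 2 * b') (c + 2 * c') (d + 2 * d') ∈ R ∨
    latticePoint (a + 3 * a') (b + 3 * b') (c + 3 * c') (d + 3 * d') ∈ R ∨
    latticePoint (a + 4 * a') (b + 4 * b') (c + 4 * c') (d + 4 * d') ∈ R := by
  have hw : ‖latticePoint a' b' c' d'‖ = 1 := by
    have := dist_latticePoint (a := a') (b := b') (c := c') (d := d')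
      (a' := 0) (b' := 0) (c' := 0) (d' := 0) 1 (by simpa using hdet) (by simpa using hquad)
    simpa [latticePoint] using this
  have hstep (k : ℤ) : latticePoint a b c d + (k : ℝ) • latticePoint a' b' c' d' =
      latticePoint (a + k * a') (b + k * b') (c + k * c') (d + k * d') := by
    simp only [latticePoint, Complex.real_smul]
    push_cast
    ring
  obtain ⟨i, hi⟩ := hR.exists_mem (latticePoint a b c d) _ hw
  have := hstep (i : ℕ)
  push_cast at this
  rw [this] at hi
  fin_cases i <;> simp at hi <;> tauto

/-- Two red points at distance `3` force two rotated red points at unit distance. -/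
theorem dist_ne_three (hR : IsRedClass R) {x y : ℂ} (hx : x ∈ R) (hy : y ∈ R) :
    dist x y ≠ 3 := by
  refine dist_ne_of_normalized (n := 3) (by norm_num) (fun S hS hO hQ => ?_) hR hx hy
  have hX : latticePoint 1 1 0 0 ∈ S := by
    simpa [hS.not_mem_of_unit hO (-1) 1 0 0, hS.not_mem_of_unit hO 0 1 0 0,
      hS.not_mem_of_unit hQ 2 1 0 0, hS.not_mem_of_unit hQ 3 1 0 0]
      using hS.exists_mem_line (-1) 1 0 0 1 0 0 0 (by norm_num) (by norm_num)
  have hY : latticePoint 2 (-1) 0 0 ∈ S := by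
    simpa [hS.not_mem_of_unit hO 0 (-1) 0 0, hS.not_mem_of_unit hO 1 (-1) 0 0,
      hS.not_mem_of_unit hQ 3 (-1) 0 0, hS.not_mem_of_unit hQ 4 (-1) 0 0]
      using hS.exists_mem_line 0 (-1) 0 0 1 0 0 0 (by norm_num) (by norm_num)
  have hX' : latticePoint 1 1 3 (-1) ∈ S := by
    simpa [hS.not_mem_of_unit hO 1 1 (-1) (-1), hS.not_mem_of_unit hX 1 1 0 (-1),
      hS.not_mem_of_unit hX 1 1 1 (-1), hS.not_mem_of_unit hQ 1 1 2 (-1)]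
      using hS.exists_mem_line 1 1 (-1) (-1) 0 0 1 0 (by norm_num) (by norm_num)
  have hY' : latticePoint 2 (-1) 2 1 ∈ S := by
    simpa [hS.not_mem_of_unit hO 2 (-1) (-2) 1, hS.not_mem_of_unit hY 2 (-1) (-1) 1,
      hS.not_mem_of_unit hY 2 (-1) 0 1, hS.not_mem_of_unit hQ 2 (-1) 1 1]
      using hS.exists_mem_line 2 (-1) (-2) 1 0 0 1 0 (by norm_num) (by norm_num)
  exact hS.not_mem_of_unit hX' 2 (-1) 2 1 (by norm_num) (by norm_num) hY'

theorem not_mem_of_three (hR : IsRedClass R) {a b : ℤ} (h : latticePoint a b 0 0 ∈ R)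
    (a' b' : ℤ) (hquad : (a - a') ^ 2 + (a - a') * (b - b') + (b - b') ^ 2 = 9) :
    latticePoint a' b' 0 0 ∉ R := fun h' =>
  hR.dist_ne_three h h' (by simpa using dist_latticePoint 3 (by simp) (by simp [hquad]))

theorem dist_ne_two (hR : IsRedClass R) {x y : ℂ} (hx : x ∈ R) (hy : y ∈ R) :
    dist x y ≠ 2 := by
  refine dist_ne_of_normalized (n := 2) (by norm_num) (fun S hS hO hQ => ?_) hR hx hy
  have hX : latticePoint (-2) 1 0 0 ∈ S := by
    simpa [hS.not_mem_of_unit hO (-1) 1 0 0, hS.not_mem_of_unit hO 0 1 0 0,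
      hS.not_mem_of_unit hQ 1 1 0 0, hS.not_mem_of_unit hQ 2 1 0 0]
      using hS.exists_mem_line (-2) 1 0 0 1 0 0 0 (by norm_num) (by norm_num)
  have hY : latticePoint 4 (-1) 0 0 ∈ S := by
    simpa [hS.not_mem_of_unit hO 0 (-1) 0 0, hS.not_mem_of_unit hO 1 (-1) 0 0,
      hS.not_mem_of_unit hQ 2 (-1) 0 0, hS.not_mem_of_unit hQ 3 (-1) 0 0]
      using hS.exists_mem_line 0 (-1) 0 0 1 0 0 0 (by norm_num) (by norm_num)
  simpa [hS.not_mem_of_three hX 1 (-2), hS.not_mem_of_unit hO 1 (-1) 0 0,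
    hS.not_mem_of_unit hO 1 0 0 0, hS.not_mem_of_unit hQ 1 1 0 0, hS.not_mem_of_three hY 1 2]
    using hS.exists_mem_line 1 (-2) 0 0 0 1 0 0 (by norm_num) (by norm_num)

theorem dist_ne_four (hR : IsRedClass R) {x y : ℂ} (hx : x ∈ R) (hy : y ∈ R) :
    dist x y ≠ 4 := by
  refine dist_ne_of_normalized (n := 4) (by norm_num) (fun S hS hO hQ => ?_) hR hx hy
  have hX : latticePoint 1 1 0 0 ∈ S ∨ latticePoint 2 1 0 0 ∈ S := by
    simpa [hS.not_mem_of_unit hO (-1) 1 0 0, hS.not_mem_of_unit hO 0 1 0 0,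
      hS.not_mem_of_unit hQ 3 1 0 0]
      using hS.exists_mem_line (-1) 1 0 0 1 0 0 0 (by norm_num) (by norm_num)
  rcases hX with hX | hX
  · simpa [hS.not_mem_of_three hO 0 3, hS.not_mem_of_unit hX 1 2 0 0,
      hS.not_mem_of_unit hX 2 1 0 0, hS.not_mem_of_three hO 3 0, hS.not_mem_of_unit hQ 4 (-1) 0 0]
      using hS.exists_mem_line 0 3 0 0 1 (-1) 0 0 (by norm_num) (by norm_num)
  · simpa [hS.not_mem_of_unit hO 1 (-1) 0 0, hS.not_mem_of_unit hO 1 0 0 0,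
      hS.not_mem_of_unit hX 1 1 0 0, hS.not_mem_of_unit hX 1 2 0 0, hS.not_mem_of_three hQ 1 3]
      using hS.exists_mem_line 1 (-1) 0 0 0 1 0 0 (by norm_num) (by norm_num)

theorem mem_of_dist_eq_five (hR : IsRedClass R) {x y : ℂ} (hx : x ∈ R) (hxy : dist x y = 5) :
    y ∈ R := by
  set u : ℂ := (y - x) / 5 with hu
  have hnorm : ‖u‖ = 1 := by
    rw [hu, norm_div, ← dist_eq_norm, dist_comm, hxy]
    norm_num
  have hdist (r : ℝ) (hr : 0 ≤ r) : dist x (x + r • u) = r := by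
    simp [dist_eq_norm, hnorm, abs_of_nonneg hr]
  obtain ⟨i, hi⟩ := hR.exists_mem (x + u) u hnorm
  have hstep : x + u + (i : ℝ) • u = x + ((i : ℝ) + 1) • u := by module
  rw [hstep] at hi
  have hd := hdist ((i : ℝ) + 1) (by positivity)
  fin_cases i
  · exact absurd (by simpa using hd) (hR.dist_ne_one _ hx _ hi)
  · exact absurd (hd.trans (by norm_num)) (hR.dist_ne_two hx hi)
  · exact absurd (hd.trans (by norm_num)) (hR.dist_ne_three hx hi)
  · exact absurd (hd.trans (by norm_num)) (hR.dist_ne_four hx hi)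
  · convert hi using 1
    simp only [hu, Complex.real_smul]
    push_cast
    ring

end IsRedClass

theorem Color.eq_red_or_eq_blue : ∀ k : Color, k = Color.red ∨ k = Color.blue
  | .red => .inl rfl
  | .blue => .inr rfl

/-- no red ℓ₂ and no blue ℓ₅ imply that every point at distance 5
from a red point is red. -/
theorem stmt_12 (c : Plane → Color) (hred : NoRedL2 c) (hblue : ¬ HasBlueL5 c) :
    ∀ A P : Plane, c A = Color.red → dist A P = 5 → c P = Color.red := by
  intro A P hA hAP
  let e : ℂ ≃ₗᵢ[ℝ] Plane := Complex.orthonormalBasisOneI.repr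
  have hR : IsRedClass {z | c (e z) = Color.red} :=
    { dist_ne_one := fun x hx y hy => by
        simpa using hred _ _ hx hy
      exists_mem := fun p w hw => by
        by_contra! h
        refine hblue ⟨e p, e w, by simpa using hw, fun i => ?_⟩
        rw [← map_smul, ← map_add]
        exact (Color.eq_red_or_eq_blue _).resolve_left (h i) }
  have h := hR.mem_of_dist_eq_five (x := e.symm A) (y := e.symm P) (by simpa using hA)
    (by simpa using hAP)
  simpa using h
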